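/- Let S be a metric space, (μ_n) Borel probability measures on S converging weakly to μ, and (f_n) measurable extended-real-valued functions on S. Suppose there is a bounded above measurable real-valued function g on S with f_n(s) ≥ g(s) for all n ≥ 1 and s ∈ S, and −∞ < ∫_S ḡ(s) dμ(s) = lim_{n→∞} ∫_S g dμ_n, where ḡ(s) = limsup_{s'→s} g(s'). Then ∫_S liminf_{n→∞, s'→s} f_n(s') dμ(s) ≤ liminf_{n→∞} ∫_S f_n dμ_n. -/

import Mathlib

open MeasureTheory Filter Topology ENNReal

/-- The positive part of an extended real number, as an element of `ℝ≥0∞`. -/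
noncomputable def eposPart (x : EReal) : ℝ≥0∞ :=
  if x = ⊤ then ⊤ else ENNReal.ofReal x.toReal

/-- The integral of an extended-real-valued function: `∫ f⁺ dμ − ∫ f⁻ dμ`. -/
noncomputable def eintegral {S : Type*} [MeasurableSpace S]
    (μ : MeasureTheory.Measure S) (f : S → EReal) : EReal :=
  ((∫⁻ s, eposPart (f s) ∂μ : ℝ≥0∞) : EReal) -
    ((∫⁻ s, eposPart (-f s) ∂μ : ℝ≥0∞) : EReal)

/-- The integral of an extended-real-valued function `f` is defined when
`min(∫ f⁺ dμ, ∫ f⁻ dμ) < ∞`. -/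
def EIntegralDefined {S : Type*} [MeasurableSpace S]
    (μ : MeasureTheory.Measure S) (f : S → EReal) : Prop :=
  (∫⁻ s, eposPart (f s) ∂μ) ≠ ⊤ ∨ (∫⁻ s, eposPart (-f s) ∂μ) ≠ ⊤


lemma aux_lsc {S ι β : Type*} [TopologicalSpace S] [CompleteLinearOrder β] [DenselyOrdered β]
    (l : Filter ι) (u : ι × S → β) :
    LowerSemicontinuous (fun s => liminf u (l ×ˢ 𝓝 s)) := by
  intro s a ha
  obtain ⟨b, hab, hb⟩ := exists_between ha
  have h1 : ∀ᶠ p in l ×ˢ 𝓝 s, b < u p := eventually_lt_of_lt_liminf hb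
  obtain ⟨pa, hpa, pb, hpb, h⟩ := eventually_prod_iff.1 h1
  filter_upwards [eventually_eventually_nhds.2 hpb] with s' hs'
  refine lt_of_lt_of_le hab (le_liminf_of_le (by isBoundedDefault) ?_)
  exact eventually_prod_iff.2 ⟨pa, hpa, pb, hs', fun hx y hy => (h hx hy).le⟩

lemma aux_lsc' {S β : Type*} [TopologicalSpace S] [CompleteLinearOrder β] [DenselyOrdered β]
    (u : S → β) :
    LowerSemicontinuous (fun s => liminf u (𝓝 s)) := by
  intro s a ha
  obtain ⟨b, hab, hb⟩ := exists_between ha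
  have h1 : ∀ᶠ p in 𝓝 s, b < u p := eventually_lt_of_lt_liminf hb
  filter_upwards [eventually_eventually_nhds.2 h1] with s' hs'
  refine lt_of_lt_of_le hab (le_liminf_of_le (by isBoundedDefault) ?_)
  exact hs'.mono fun _ h => h.le

lemma aux_liminf_le_self {S β : Type*} [TopologicalSpace S] [CompleteLinearOrder β]
    (u : S → β) (s : S) : liminf u (𝓝 s) ≤ u s :=
  liminf_le_of_le (by isBoundedDefault) fun _ h => h.self_of_nhds

/-- Portmanteau for lower semicontinuous functions with values in `[0, ∞]`. -/
lemma aux_portmanteau {S : Type*} [TopologicalSpace S] [MeasurableSpace S] [BorelSpace S]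
    (μs : ℕ → Measure S) (μ : Measure S)
    (hopen : ∀ U : Set S, IsOpen U → μ U ≤ liminf (fun n => μs n U) atTop)
    (φ : S → ℝ≥0∞) (hφ : LowerSemicontinuous φ) :
    ∫⁻ s, φ s ∂μ ≤ liminf (fun n => ∫⁻ s, φ s ∂(μs n)) atTop := by
  have hφm : Measurable φ := hφ.measurable
  have key : ∀ k : ℕ, ∫⁻ s, min (φ s) k ∂μ ≤ liminf (fun n => ∫⁻ s, φ s ∂(μs n)) atTop := by
    intro k
    have hm : Measurable fun s => (min (φ s) (k : ℝ≥0∞)).toReal :=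
      (hφm.min measurable_const).ennreal_toReal
    have hlc : ∀ ν : Measure S, ∫⁻ s, min (φ s) k ∂ν =
        ∫⁻ t in Set.Ioi (0:ℝ), ν {a | t < (min (φ a) (k : ℝ≥0∞)).toReal} := by
      intro ν
      rw [← lintegral_eq_lintegral_meas_lt ν (Eventually.of_forall fun s => by simp)
        hm.aemeasurable]
      refine lintegral_congr fun s => (ENNReal.ofReal_toReal ?_).symm
      exact ne_top_of_le_ne_top (ENNReal.natCast_ne_top k) (min_le_right _ _)
    have hop : ∀ t : ℝ, 0 < t → IsOpen {a | t < (min (φ a) (k : ℝ≥0∞)).toReal} := by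
      intro t ht
      have : {a | t < (min (φ a) (k : ℝ≥0∞)).toReal} =
          {a | ENNReal.ofReal t < φ a} ∩ {a | ENNReal.ofReal t < (k : ℝ≥0∞)} := by
        ext a
        simp only [Set.mem_ofPred_eq, Set.mem_inter_iff]
        rw [← lt_min_iff, ENNReal.ofReal_lt_iff_lt_toReal ht.le]
        exact ne_top_of_le_ne_top (ENNReal.natCast_ne_top k) (min_le_right _ _)
      rw [this]
      exact (hφ.isOpen_preimage _).inter isOpen_const
    calc ∫⁻ s, min (φ s) k ∂μ
        = ∫⁻ t in Set.Ioi (0:ℝ), μ {a | t < (min (φ a) (k : ℝ≥0∞)).toReal} := hlc μ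
      _ ≤ ∫⁻ t in Set.Ioi (0:ℝ),
            liminf (fun n => μs n {a | t < (min (φ a) (k : ℝ≥0∞)).toReal}) atTop :=
          setLIntegral_mono' measurableSet_Ioi fun t ht => hopen _ (hop t ht)
      _ ≤ liminf (fun n => ∫⁻ t in Set.Ioi (0:ℝ),
            μs n {a | t < (min (φ a) (k : ℝ≥0∞)).toReal}) atTop := by
          refine lintegral_liminf_le fun n => Antitone.measurable ?_
          intro t t' htt
          exact measure_mono fun a ha => lt_of_le_of_lt htt ha
      _ ≤ _ := by
          refine liminf_le_liminf (Eventually.of_forall fun n => ?_)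
          rw [← hlc]
          exact lintegral_mono fun s => min_le_left _ _
  have hsup : ∀ s, φ s = ⨆ k : ℕ, min (φ s) k := by
    intro s
    rw [← inf_iSup_eq, ENNReal.iSup_natCast]; simp
  calc ∫⁻ s, φ s ∂μ = ∫⁻ s, ⨆ k : ℕ, min (φ s) k ∂μ := lintegral_congr hsup
    _ = ⨆ k : ℕ, ∫⁻ s, min (φ s) k ∂μ := by
        refine lintegral_iSup (fun k => hφm.min measurable_const) ?_
        intro i j hij s
        exact min_le_min_left _ (by exact_mod_cast hij)
    _ ≤ _ := iSup_le key

/-- Fatou for nonnegative functions. -/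
lemma aux_fatou {S : Type*} [TopologicalSpace S] [MeasurableSpace S] [BorelSpace S]
    (μs : ℕ → Measure S) (μ : Measure S)
    (hopen : ∀ U : Set S, IsOpen U → μ U ≤ liminf (fun n => μs n U) atTop)
    (H : ℕ → S → ℝ≥0∞) :
    ∫⁻ s, liminf (fun p : ℕ × S => H p.1 p.2) (atTop ×ˢ 𝓝 s) ∂μ ≤
      liminf (fun n => ∫⁻ s, H n s ∂(μs n)) atTop := by
  let φ : ℕ → S → ℝ≥0∞ := fun N s => liminf (fun s' => ⨅ m ≥ N, H m s') (𝓝 s)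
  have hφ : ∀ N, LowerSemicontinuous (φ N) := fun N => aux_lsc' _
  have hle : ∀ s, liminf (fun p : ℕ × S => H p.1 p.2) (atTop ×ˢ 𝓝 s) ≤ ⨆ N, φ N s := by
    intro s
    refine le_of_forall_lt fun a ha => ?_
    obtain ⟨b, hab, hb⟩ := exists_between ha
    refine lt_of_lt_of_le hab ?_
    have h1 := eventually_lt_of_lt_liminf hb
    obtain ⟨pa, hpa, pb, hpb, h⟩ := eventually_prod_iff.1 h1
    obtain ⟨N, hN⟩ := eventually_atTop.1 hpa
    refine le_trans ?_ (le_iSup _ N)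
    refine le_liminf_of_le (by isBoundedDefault) ?_
    filter_upwards [hpb] with s' hs'
    exact le_iInf₂ fun m hm => (h (hN m hm) hs').le
  calc _ ≤ ∫⁻ s, ⨆ N, φ N s ∂μ := lintegral_mono hle
    _ = ⨆ N, ∫⁻ s, φ N s ∂μ := by
        refine lintegral_iSup (fun N => (hφ N).measurable) ?_
        intro i j hij s
        refine liminf_le_liminf (Eventually.of_forall fun s' => ?_)
        exact le_iInf₂ fun m hm => iInf₂_le m (le_trans hij hm)
    _ ≤ _ := by
        refine iSup_le fun N => (aux_portmanteau μs μ hopen _ (hφ N)).trans ?_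
        refine liminf_le_liminf ?_
        filter_upwards [eventually_ge_atTop N] with n hn
        exact lintegral_mono fun s => (aux_liminf_le_self _ s).trans (iInf₂_le n hn)

lemma eposPart_eq (x : EReal) : eposPart x = x.toENNReal := rfl

lemma aux_pw_le (a : EReal) (b : ℝ) :
    eposPart a + eposPart (-(b : EReal)) ≤
      eposPart (a - b) + eposPart b + eposPart (-a) := by
  simp only [eposPart_eq]
  induction a with
  | bot => simp
  | top => simp
  | coe a =>
    rw [← EReal.coe_neg, ← EReal.coe_neg, ← EReal.coe_sub]
    simp only [EReal.real_coe_toENNReal, ENNReal.ofReal]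
    norm_cast
    rw [← NNReal.coe_le_coe]
    push_cast
    simp only [Real.coe_toNNReal']
    grind

lemma aux_pw_ge (a : EReal) (b : ℝ) (h : (b : EReal) ≤ a) :
    eposPart (a - b) + eposPart b + eposPart (-a) ≤
      eposPart a + eposPart (-(b : EReal)) := by
  simp only [eposPart_eq]
  induction a with
  | bot => simp at h
  | top => simp
  | coe a =>
    have h' : b ≤ a := by exact_mod_cast h
    rw [← EReal.coe_neg, ← EReal.coe_neg, ← EReal.coe_sub]
    simp only [EReal.real_coe_toENNReal, ENNReal.ofReal]
    norm_cast
    rw [← NNReal.coe_le_coe]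
    push_cast
    simp only [Real.coe_toNNReal']
    grind

lemma aux_arith_le (A B C D E : ℝ≥0∞) (hB : B ≠ ⊤) (hD : D ≠ ⊤) (hE : E ≠ ⊤)
    (h : A + B ≤ C + D + E) : (A : EReal) - E ≤ C + ((D : EReal) - B) := by
  lift B to NNReal using hB
  lift D to NNReal using hD
  lift E to NNReal using hE
  induction C with
  | top =>
    have : ((D : ℝ≥0∞) : EReal) - ((B : ℝ≥0∞) : EReal) ≠ ⊥ := by
      change ((D : ℝ) : EReal) - ((B : ℝ) : EReal) ≠ ⊥
      rw [← EReal.coe_sub]; exact EReal.coe_ne_bot _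
    rw [EReal.coe_ennreal_top, EReal.top_add_of_ne_bot this]
    exact le_top
  | coe C =>
    have hA : A ≠ ⊤ := by
      rintro rfl
      simp at h
    lift A to NNReal using hA
    have h' : (A : ℝ) + B ≤ C + D + E := by exact_mod_cast h
    change ((A : ℝ) : EReal) - ((E : ℝ) : EReal) ≤ ((C : ℝ) : EReal) + (((D : ℝ) : EReal) - ((B : ℝ) : EReal))
    norm_cast
    push_cast
    linarith

lemma aux_arith_ge (A B C D E : ℝ≥0∞) (hB : B ≠ ⊤) (hD : D ≠ ⊤) (hE : E ≠ ⊤)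
    (h : C + D + E ≤ A + B) : (C : EReal) + ((D : EReal) - B) ≤ (A : EReal) - E := by
  lift B to NNReal using hB
  lift D to NNReal using hD
  lift E to NNReal using hE
  induction A with
  | top =>
    change _ ≤ (⊤ : EReal) - ((E : ℝ) : EReal)
    rw [EReal.top_sub_coe]
    exact le_top
  | coe A =>
    have hC : C ≠ ⊤ := by
      rintro rfl
      simp at h
    lift C to NNReal using hC
    have h' : (C : ℝ) + D + E ≤ A + B := by exact_mod_cast h
    change ((C : ℝ) : EReal) + (((D : ℝ) : EReal) - ((B : ℝ) : EReal)) ≤ ((A : ℝ) : EReal) - ((E : ℝ) : EReal)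
    norm_cast
    push_cast
    linarith

lemma aux_meas {S : Type*} [MeasurableSpace S] {f : S → EReal} (hf : Measurable f) :
    Measurable fun s => eposPart (f s) := hf.ereal_toENNReal

lemma aux_meas_neg {S : Type*} [MeasurableSpace S] {f : S → EReal} (hf : Measurable f) :
    Measurable fun s => eposPart (-f s) := hf.neg.ereal_toENNReal

lemma aux_int_finite {S : Type*} [MeasurableSpace S] (ν : Measure S) [IsProbabilityMeasure ν]
    (f : S → EReal) (K : ℝ) (hK : ∀ s, f s ≤ K) : ∫⁻ s, eposPart (f s) ∂ν ≠ ⊤ := by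
  refine ne_top_of_le_ne_top (b := ENNReal.ofReal K) ENNReal.ofReal_ne_top ?_
  calc _ ≤ ∫⁻ _, ENNReal.ofReal K ∂ν :=
        lintegral_mono fun s => EReal.toENNReal_le_toENNReal (hK s)
    _ = _ := by simp

lemma aux_neg_finite {S : Type*} [MeasurableSpace S] (ν : Measure S)
    (f : S → EReal) (h : ⊥ < eintegral ν f) : ∫⁻ s, eposPart (-f s) ∂ν ≠ ⊤ := by
  intro h'
  rw [eintegral, h'] at h
  simp at h

/-- Corollary: Fatou's lemma for weakly converging probability measures when
the functions `f_n` are bounded below by a single bounded-above measurable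
function `g` whose upper envelope `ḡ(s) = limsup_{s'→s} g(s')` satisfies
`−∞ < ∫ ḡ dμ = lim_n ∫ g dμ_n`. -/
theorem fatou_weak_convergence_single_minorant
    {S : Type*} [MetricSpace S] [MeasurableSpace S] [BorelSpace S]
    (μs : ℕ → Measure S) (μ : Measure S)
    [∀ n, IsProbabilityMeasure (μs n)] [IsProbabilityMeasure μ]
    (hweak : ∀ h : S → ℝ, Continuous h → (∃ C : ℝ, ∀ s, |h s| ≤ C) →
      Tendsto (fun n => ∫ s, h s ∂(μs n)) atTop (𝓝 (∫ s, h s ∂μ)))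
    (f : ℕ → S → EReal) (hf : ∀ n, Measurable (f n))
    (g : S → ℝ) (hg : Measurable g) (K : ℝ) (hK : ∀ s, g s ≤ K)
    (hfg : ∀ n s, (g s : EReal) ≤ f n s)
    (hdf : ∀ n, EIntegralDefined (μs n) (f n))
    (hdliminf : EIntegralDefined μ
      (fun s => liminf (fun p : ℕ × S => f p.1 p.2) (atTop ×ˢ 𝓝 s)))
    (hbound : ⊥ < eintegral μ
      (fun s => limsup (fun s' => (g s' : EReal)) (𝓝 s)))
    (hlim : Tendsto (fun n => eintegral (μs n) (fun s => (g s : EReal))) atTop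
      (𝓝 (eintegral μ (fun s => limsup (fun s' => (g s' : EReal)) (𝓝 s))))) :
    eintegral μ (fun s => liminf (fun p : ℕ × S => f p.1 p.2) (atTop ×ˢ 𝓝 s)) ≤
      liminf (fun n => eintegral (μs n) (f n)) atTop := by
  classical
  set F : S → EReal := fun s => liminf (fun p : ℕ × S => f p.1 p.2) (atTop ×ˢ 𝓝 s) with hF
  set G : S → EReal := fun s => limsup (fun s' => (g s' : EReal)) (𝓝 s) with hG
  have hopen : ∀ U : Set S, IsOpen U → μ U ≤ liminf (fun n => μs n U) atTop := by
    intro U hU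
    let P : ProbabilityMeasure S := ⟨μ, inferInstance⟩
    let Ps : ℕ → ProbabilityMeasure S := fun n => ⟨μs n, inferInstance⟩
    have ht : Tendsto Ps atTop (𝓝 P) := by
      rw [ProbabilityMeasure.tendsto_iff_forall_integral_tendsto]
      intro h
      exact hweak h h.continuous ⟨‖h‖, fun s => h.norm_coe_le_norm s⟩
    exact ProbabilityMeasure.le_liminf_measure_open_of_tendsto ht hU
  have hFm : Measurable F := (aux_lsc atTop fun p : ℕ × S => f p.1 p.2).measurable
  have hGneg : ∀ s, liminf (fun s' => -(g s' : EReal)) (𝓝 s) = - G s := fun s =>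
    EReal.liminf_neg (v := fun s' => (g s' : EReal)) (f := 𝓝 s)
  have hGm : Measurable G := by
    have h1 : Measurable fun s => liminf (fun s' => -(g s' : EReal)) (𝓝 s) :=
      (aux_lsc' fun s' => -(g s' : EReal)).measurable
    have h2 : G = fun s => - liminf (fun s' => -(g s' : EReal)) (𝓝 s) := by
      funext s; rw [hGneg, neg_neg]
    rw [h2]; exact h1.neg
  have hGK : ∀ s, G s ≤ K := fun s =>
    limsup_le_of_le (by isBoundedDefault) (Eventually.of_forall fun s' => by exact_mod_cast hK s')
  have hgG : ∀ s, (g s : EReal) ≤ G s := fun s =>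
    le_limsup_of_le (by isBoundedDefault) fun _ h => h.self_of_nhds
  have hGr : ∀ s, ∃ r : ℝ, (r : EReal) = G s := fun s =>
    ⟨(G s).toReal, EReal.coe_toReal (ne_top_of_le_ne_top (EReal.coe_ne_top K) (hGK s))
      (ne_bot_of_le_ne_bot (EReal.coe_ne_bot _) (hgG s))⟩
  have hGp := aux_int_finite μ G K hGK
  have hGn := aux_neg_finite μ G hbound
  let H : ℕ → S → ℝ≥0∞ := fun n s => eposPart (f n s - g s)
  -- pointwise comparison
  have hpt : ∀ s, eposPart (F s - G s) ≤
      liminf (fun p : ℕ × S => H p.1 p.2) (atTop ×ˢ 𝓝 s) := by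
    intro s
    have h1 : liminf (fun p : ℕ × S => -(g p.2 : EReal)) (atTop ×ˢ 𝓝 s) = - G s := by
      rw [← hGneg]
      have : (fun p : ℕ × S => -(g p.2 : EReal)) = (fun s' => -(g s' : EReal)) ∘ Prod.snd := rfl
      rw [this, liminf_comp, map_snd_prod]
    have h2 : F s - G s ≤ liminf (fun p : ℕ × S => f p.1 p.2 - g p.2) (atTop ×ˢ 𝓝 s) := by
      rw [sub_eq_add_neg, ← h1]
      exact EReal.le_liminf_add
    have h3 := Monotone.map_liminf_of_continuousAt (F := atTop ×ˢ 𝓝 s)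
      (f := EReal.toENNReal) (fun _ _ h => EReal.toENNReal_le_toENNReal h)
      (fun p : ℕ × S => f p.1 p.2 - g p.2) EReal.continuous_toENNReal.continuousAt
    exact (EReal.toENNReal_le_toENNReal h2).trans h3.le
  have hfat := aux_fatou μs μ hopen H
  -- the limit side
  have hleft : eintegral μ F ≤ ((∫⁻ s, eposPart (F s - G s) ∂μ : ℝ≥0∞) : EReal) + eintegral μ G := by
    by_cases hFn : ∫⁻ s, eposPart (-F s) ∂μ = ⊤
    · rw [eintegral, hFn]; simp
    · refine aux_arith_le _ _ _ _ _ hGn hGp hFn ?_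
      rw [← lintegral_add_right _ (aux_meas_neg hGm), ← lintegral_add_right _ (aux_meas hGm),
        ← lintegral_add_right _ (aux_meas_neg hFm)]
      refine lintegral_mono fun s => ?_
      obtain ⟨r, hr⟩ := hGr s
      have := aux_pw_le (F s) r
      rw [hr] at this
      exact this
  have hgm : Measurable fun s => (g s : EReal) := hg.coe_real_ereal
  have hright : ∀ᶠ n in atTop, ((∫⁻ s, H n s ∂(μs n) : ℝ≥0∞) : EReal) +
      eintegral (μs n) (fun s => (g s : EReal)) ≤ eintegral (μs n) (f n) := by
    filter_upwards [hlim.eventually (lt_mem_nhds hbound)] with n hn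
    have hgp := aux_int_finite (μs n) (fun s => (g s : EReal)) K
      fun s => by exact_mod_cast hK s
    have hgn := aux_neg_finite (μs n) _ hn
    have hfn : ∫⁻ s, eposPart (-f n s) ∂(μs n) ≠ ⊤ :=
      ne_top_of_le_ne_top hgn (lintegral_mono fun s =>
        EReal.toENNReal_le_toENNReal (EReal.neg_le_neg_iff.2 (hfg n s)))
    refine aux_arith_ge _ _ _ _ _ hgn hgp hfn ?_
    beta_reduce
    rw [← lintegral_add_right _ (aux_meas_neg hgm), ← lintegral_add_right _ (aux_meas hgm),
        ← lintegral_add_right _ (aux_meas_neg (hf n))]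
    exact lintegral_mono fun s => aux_pw_ge _ _ (hfg n s)
  have hco : ((liminf (fun n => ∫⁻ s, H n s ∂(μs n)) atTop : ℝ≥0∞) : EReal) =
      liminf (fun n => ((∫⁻ s, H n s ∂(μs n) : ℝ≥0∞) : EReal)) atTop :=
    Monotone.map_liminf_of_continuousAt (F := atTop)
      (f := ((↑) : ℝ≥0∞ → EReal)) (fun _ _ h => EReal.coe_ennreal_le_coe_ennreal_iff.2 h)
      (fun n => ∫⁻ s, H n s ∂(μs n)) continuous_coe_ennreal_ereal.continuousAt
  calc eintegral μ F
      ≤ ((∫⁻ s, eposPart (F s - G s) ∂μ : ℝ≥0∞) : EReal) + eintegral μ G := hleft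
    _ ≤ liminf (fun n => ((∫⁻ s, H n s ∂(μs n) : ℝ≥0∞) : EReal)) atTop +
        liminf (fun n => eintegral (μs n) (fun s => (g s : EReal))) atTop := by
        rw [hlim.liminf_eq, ← hco]
        refine add_le_add_left ?_ _
        exact EReal.coe_ennreal_le_coe_ennreal_iff.2 ((lintegral_mono hpt).trans hfat)
    _ ≤ _ := EReal.le_liminf_add
    _ ≤ _ := liminf_le_liminf hright
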